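/- arXiv:1702.06431 — 2 statements merged into one kernel-verified Lean document; each statement's English description precedes it below -/
import Mathlib

section
/- Let m₁, m₂, m₁₂ be real numbers with m₁ > −1, m₂ > −1, m₁₂ ≥ 0, m₂ ∉ ℤ, and m₁ + m₁₂ ∉ ℤ. Then F₋(m₁, m₂; m₁₂) = ((e^{2πi m₂} − 1)/(2πi)) · ((e^{2πi(m₁ + m₁₂)} − 1)/(2πi)) · (1/(m₁ + m₂ + m₁₂ + 2)) · ( B(m₂+1, m₁₂+1) + (sin(π m₁)/sin(π(m₁ + m₁₂))) · B(m₁+1, m₁₂+1) ). -/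
open MeasureTheory
open scoped Classical

/-- The formal residue coefficient `Res(m)`. -/
noncomputable def Res (m : ℝ) : ℂ :=
  if m = -1 then 1
  else if ∃ z : ℤ, (z : ℝ) = m then 0
  else (Complex.exp (2 * Real.pi * Complex.I * ((m : ℂ) + 1)) - 1) /
    (2 * Real.pi * Complex.I * ((m : ℂ) + 1))

/-- Generalized binomial coefficient `binom(m, k)` for a real `m`. -/
noncomputable def gbinom (m : ℝ) (k : ℕ) : ℝ :=
  (∏ i ∈ Finset.range k, (m - i)) / (Nat.factorial k)

/-- Upper-triangular index pairs `i < j` in `Fin n`. -/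
abbrev UT (n : ℕ) := {p : Fin n × Fin n // p.1 < p.2}

/-- The exponent `E_i = m_i + ∑_{j>i}(m_{ij} - k_{ij}) + ∑_{j<i} k_{ji}`. -/
noncomputable def Eexp (n : ℕ) (m : Fin n → ℝ) (mm : Fin n → Fin n → ℝ)
    (K : UT n → ℕ) (i : Fin n) : ℝ :=
  m i + (∑ p : UT n, (if p.1.1 = i then mm p.1.1 p.1.2 - K p else 0))
      + ∑ p : UT n, (if p.1.2 = i then (K p : ℝ) else 0)

/-- One term of the series defining the quantum monodromy number `F₋`. -/
noncomputable def FminusTerm (n : ℕ) (m : Fin n → ℝ) (mm : Fin n → Fin n → ℝ)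
    (K : UT n → ℕ) : ℂ :=
  (∏ i : Fin n, Res (Eexp n m mm K i)) *
    ∏ p : UT n, ((-1 : ℂ) ^ K p * (gbinom (mm p.1.1 p.1.2) (K p) : ℂ))

/-- The quantum monodromy number `F₋((m_i, m_{ij})_{ij})`. -/
noncomputable def Fminus (n : ℕ) (m : Fin n → ℝ) (mm : Fin n → Fin n → ℝ) : ℂ :=
  ∑' K : UT n → ℕ, FminusTerm n m mm K

/-- The simplex `1 ≥ z₁ > ⋯ > zₙ ≥ 0`. -/
def simplexSet (n : ℕ) : Set (Fin n → ℝ) :=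
  {z | (∀ i, 0 ≤ z i ∧ z i ≤ 1) ∧ ∀ i j : Fin n, i < j → z j < z i}

/-- The generalized Selberg integral `Sel((m_i; m̄_i; m_{ij}))`. -/
noncomputable def Sel (n : ℕ) (m mbar : Fin n → ℝ) (mm : Fin n → Fin n → ℝ) : ℝ :=
  ∫ z in simplexSet n,
    (∏ i, z i ^ m i) * (∏ i, (1 - z i) ^ mbar i) *
      ∏ p : UT n, (z p.1.1 - z p.1.2) ^ mm p.1.1 p.1.2

/-- The shuffles `S_{k, \overline{n-k}}`: increasing on the first `k` positions,
decreasing on the remaining positions (0-indexed). -/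
def SbarFinset (n k : ℕ) : Finset (Equiv.Perm (Fin n)) :=
  Finset.univ.filter (fun η =>
    (∀ i j : Fin n, i < j → (j : ℕ) < k → η i < η j) ∧
    (∀ i j : Fin n, i < j → k ≤ (i : ℕ) → η j < η i))

/-- The inversion number `ℓ(η)` of a permutation. -/
def invNum {n : ℕ} (η : Equiv.Perm (Fin n)) : ℕ :=
  (Finset.univ.filter (fun p : Fin n × Fin n => p.1 < p.2 ∧ η p.2 < η p.1)).card

/-- The reduced quantum monodromy number `F̃₋((m_i; m_{ij}))`. -/
noncomputable def Ftilde (n : ℕ) (m : Fin n → ℝ) (mm : Fin n → Fin n → ℝ) : ℂ :=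
  (2 * Real.pi * Complex.I)⁻¹ ^ n *
    ∑ k ∈ Finset.range (n + 1), (-1 : ℂ) ^ k *
      (∏ i ∈ Finset.univ.filter (fun i : Fin n => k ≤ (i : ℕ)),
        Complex.exp (2 * Real.pi * Complex.I * (m i))) *
      ∑ η ∈ SbarFinset n k,
        (∏ p ∈ Finset.univ.filter
            (fun p : Fin n × Fin n => p.1 < p.2 ∧ η p.2 < η p.1),
          Complex.exp (Real.pi * Complex.I * (mm p.1 p.2))) *
        (Sel n (fun i => m (η⁻¹ i)) (fun _ => 0) (fun i j => mm (η⁻¹ i) (η⁻¹ j)) : ℂ)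

/-- The braiding factor `q(σ) = exp(πi ∑_{i<j, σ(i)>σ(j)} m_{ij})`. -/
noncomputable def qfac {n : ℕ} (mm : Fin n → Fin n → ℝ) (σ : Equiv.Perm (Fin n)) : ℂ :=
  Complex.exp (Real.pi * Complex.I *
    (∑ p ∈ Finset.univ.filter (fun p : Fin n × Fin n => p.1 < p.2 ∧ σ p.2 < σ p.1),
      (mm p.1 p.2 : ℂ)))

/-- The Euler Beta function as a real integral. -/
noncomputable def Beta (x y : ℝ) : ℝ :=
  ∫ t in (0:ℝ)..1, t ^ (x - 1) * (1 - t) ^ (y - 1)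

open Filter Topology

/-- The signed binomial coefficient `(-1)^k * binom(c, k)`. -/
noncomputable def altBinom (c : ℝ) (k : ℕ) : ℝ := (-1) ^ k * gbinom c k

theorem gbinom_eq_choose (c : ℝ) (k : ℕ) : gbinom c k = Ring.choose c k := by
  have h (n : ℕ) : (descPochhammer ℤ n).smeval c = ∏ i ∈ Finset.range n, (c - i) := by
    induction n with
    | zero => simp
    | succ n ih =>
      rw [descPochhammer_succ_right, Polynomial.smeval_mul, ih, Finset.prod_range_succ]
      simp [Polynomial.smeval_sub, Polynomial.smeval_natCast]
  rw [Ring.choose_eq_smul, h, gbinom, smul_eq_mul, div_eq_inv_mul]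

theorem altBinom_succ (c : ℝ) (k : ℕ) :
    ((k + 1 : ℕ) : ℝ) * altBinom c (k + 1) = (k - c) * altBinom c k := by
  have h : (Nat.factorial k : ℝ) ≠ 0 := by positivity
  have h' : (k : ℝ) + 1 ≠ 0 := by positivity
  simp only [altBinom, gbinom, Finset.prod_range_succ, Nat.factorial_succ, pow_succ]
  push_cast
  field_simp
  ring

theorem altBinom_zero_left (k : ℕ) : altBinom 0 (k + 1) = 0 := by
  simp [altBinom, gbinom, Finset.prod_range_succ']

theorem hasSum_altBinom_mul_pow (c : ℝ) {t : ℝ} (ht : |t| < 1) :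
    HasSum (fun k => altBinom c k * t ^ k) ((1 - t) ^ c) := by
  have h := (Real.one_add_rpow_hasFPowerSeriesOnBall_zero (a := c)).hasSum
    (y := -t) (by simpa [enorm_eq_nnnorm, ← NNReal.coe_lt_coe] using ht)
  simp only [binomialSeries_apply, ← sub_eq_add_neg, smul_eq_mul,
    List.ofFn_const, List.prod_replicate] at h
  convert! h using 2 with k
  · rw [altBinom, gbinom_eq_choose, neg_pow t k]
    ring
  · ring

theorem abs_mul_altBinom_succ {c : ℝ} {k : ℕ} (hk : c ≤ k) :
    |((k + 1 : ℕ) : ℝ) * altBinom c (k + 1)| = |k * altBinom c k| - c * |altBinom c k| := by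
  rw [altBinom_succ, abs_mul, abs_mul, abs_of_nonneg (sub_nonneg.2 hk),
    Nat.abs_cast]
  ring

theorem summable_abs_altBinom {c : ℝ} (hc : 0 ≤ c) : Summable fun k => |altBinom c k| := by
  rcases hc.eq_or_lt with rfl | hc'
  · rw [← summable_nat_add_iff 1]
    simp [altBinom_zero_left]
  obtain ⟨N, hN⟩ := exists_nat_ge c
  rw [← summable_nat_add_iff N, ← summable_mul_left_iff hc'.ne']
  refine summable_of_sum_range_le (c := |N * altBinom c N|) (fun n => by positivity) fun n => ?_
  have h : ∑ i ∈ Finset.range n, c * |altBinom c (i + N)| =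
      |N * altBinom c N| - |((n + N : ℕ) : ℝ) * altBinom c (n + N)| := by
    induction n with
    | zero => simp
    | succ n ih =>
      have hk : c ≤ ((n + N : ℕ) : ℝ) := by push_cast; linarith [Nat.cast_nonneg (α := ℝ) n]
      rw [Finset.sum_range_succ, ih, show n + 1 + N = n + N + 1 by ring,
        abs_mul_altBinom_succ hk]
      ring
  rw [h]
  linarith [abs_nonneg (((n + N : ℕ) : ℝ) * altBinom c (n + N))]

theorem exists_bound_mul_altBinom {c : ℝ} (hc : 0 ≤ c) :
    ∃ M, ∀ᶠ k : ℕ in atTop, |k * altBinom c k| ≤ M := by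
  obtain ⟨N, hN⟩ := exists_nat_ge c
  refine ⟨|N * altBinom c N|, eventually_atTop.2 ⟨N, fun k hk => ?_⟩⟩
  induction k, hk using Nat.le_induction with
  | base => exact le_rfl
  | succ k hk ih =>
    rw [abs_mul_altBinom_succ (hN.trans (by exact_mod_cast hk))]
    linarith [mul_nonneg hc (abs_nonneg (altBinom c k))]

theorem summable_altBinom_div {c : ℝ} (hc : 0 ≤ c) (x : ℝ) :
    Summable fun k : ℕ => altBinom c k / (x + k) := by
  refine (summable_abs_altBinom hc).of_norm_bounded_eventually_nat ?_
  obtain ⟨N, hN⟩ := exists_nat_ge (1 - x)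
  filter_upwards [eventually_ge_atTop N] with k hk
  have hk' : (N : ℝ) ≤ k := by exact_mod_cast hk
  rw [norm_div, Real.norm_eq_abs, Real.norm_eq_abs]
  exact div_le_self (abs_nonneg _) (by rw [abs_of_nonneg] <;> linarith)

theorem tendsto_mul_altBinom_div {c : ℝ} (hc : 0 ≤ c) (x : ℝ) :
    Tendsto (fun k : ℕ => k * altBinom c k / (x + k)) atTop (𝓝 0) := by
  obtain ⟨M, hM⟩ := exists_bound_mul_altBinom hc
  have h : Tendsto (fun k : ℕ => (x + (k : ℝ))⁻¹) atTop (𝓝 0) :=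
    tendsto_inv_atTop_zero.comp (tendsto_atTop_add_const_left _ _ tendsto_natCast_atTop_atTop)
  simp only [div_eq_mul_inv]
  refine bdd_le_mul_tendsto_zero' M ?_ h
  exact hM

theorem mul_tsum_altBinom_div {c x : ℝ} (hc : 0 ≤ c) (hx : ∀ m : ℕ, x ≠ -m) :
    x * ∑' k : ℕ, altBinom c k / (x + k) =
      (x + c + 1) * ∑' k : ℕ, altBinom c k / (x + 1 + k) := by
  have hs := ((summable_altBinom_div hc x).hasSum.mul_left x).sub
    ((summable_altBinom_div hc (x + 1)).hasSum.mul_left (x + c + 1))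
  have h (n : ℕ) : ∑ k ∈ Finset.range n, (x * (altBinom c k / (x + k)) -
      (x + c + 1) * (altBinom c k / (x + 1 + k))) = n * altBinom c n / (x + n) := by
    induction n with
    | zero => simp
    | succ n ih =>
      have h0 : x + n ≠ 0 := fun h => hx n (by linarith)
      have h1 : x + 1 + n ≠ 0 := fun h => hx (n + 1) (by push_cast; linarith)
      rw [Finset.sum_range_succ, ih, altBinom_succ, Nat.cast_succ,
        show x + ((n : ℝ) + 1) = x + 1 + n by ring]
      field_simp
      ring
  have hl := hs.tendsto_sum_nat
  simp only [h] at hl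
  exact sub_eq_zero.1 (tendsto_nhds_unique hl (tendsto_mul_altBinom_div hc x))

theorem ofReal_Beta (x y : ℝ) : (Beta x y : ℂ) = Complex.betaIntegral x y := by
  rw [Beta, Complex.betaIntegral, ← intervalIntegral.integral_ofReal]
  refine intervalIntegral.integral_congr fun t ht => ?_
  rw [Set.uIcc_of_le zero_le_one] at ht
  simp only [Complex.ofReal_mul]
  rw [Complex.ofReal_cpow ht.1, Complex.ofReal_cpow (by linarith [ht.2])]
  push_cast
  rfl

theorem Beta_eq_Gamma {x y : ℝ} (hx : 0 < x) (hy : 0 < y) :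
    Beta x y = Real.Gamma x * Real.Gamma y / Real.Gamma (x + y) := by
  have h := Complex.betaIntegral_eq_Gamma_mul_div x y (by simpa) (by simpa)
  rw [← ofReal_Beta, ← Complex.ofReal_add] at h
  simp only [Complex.Gamma_ofReal] at h
  exact_mod_cast h

theorem hasSum_altBinom_div_Beta {c x : ℝ} (hc : 0 ≤ c) (hx : 0 < x) :
    HasSum (fun k : ℕ => altBinom c k / (x + k)) (Beta x (c + 1)) := by
  have hint : IntervalIntegrable (fun t : ℝ => t ^ (x - 1)) volume 0 1 :=
    intervalIntegral.intervalIntegrable_rpow' (by linarith)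
  have key := intervalIntegral.hasSum_integral_of_dominated_convergence (μ := volume)
    (a := 0) (b := 1) (F := fun (k : ℕ) (t : ℝ) => altBinom c k * t ^ (x - 1 + k))
    (f := fun t => t ^ (x - 1) * (1 - t) ^ (c + 1 - 1))
    (fun k t => |altBinom c k| * t ^ (x - 1))
    (fun k => (by fun_prop : Measurable fun t : ℝ =>
      altBinom c k * t ^ (x - 1 + k)).aestronglyMeasurable)
    (fun k => ae_of_all _ fun t ht => ?_) (ae_of_all _ fun t ht => ?_) ?_ ?_
  · convert! key using 2 with k
    have : 0 < x + k := by positivity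
    rw [intervalIntegral.integral_const_mul, integral_rpow (Or.inl (by linarith)),
      show x - 1 + k + 1 = x + k by ring, Real.zero_rpow this.ne', Real.one_rpow]
    ring
  · rw [Set.uIoc_of_le zero_le_one] at ht
    rw [norm_mul, Real.norm_eq_abs, Real.norm_of_nonneg (by have := ht.1; positivity)]
    gcongr ?_ * ?_
    exact Real.rpow_le_rpow_of_exponent_ge ht.1 ht.2 (by simp)
  · exact (summable_abs_altBinom hc).mul_right _
  · simp only [tsum_mul_right]
    exact hint.const_mul _
  · have h1 : ∀ᵐ t : ℝ, t ≠ 1 := by simp [ae_iff, measure_singleton]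
    filter_upwards [h1] with t ht1 ht
    rw [Set.uIoc_of_le zero_le_one] at ht
    have h := (hasSum_altBinom_mul_pow c (t := t)
      (by rw [abs_of_pos ht.1]; exact lt_of_le_of_ne ht.2 ht1)).mul_left (t ^ (x - 1))
    rw [add_sub_cancel_right]
    convert! h using 2 with k
    rw [Real.rpow_add ht.1, Real.rpow_natCast]
    ring

theorem tsum_altBinom_div {c x : ℝ} (hc : 0 ≤ c) (hx : ∀ m : ℕ, x ≠ -m) :
    ∑' k : ℕ, altBinom c k / (x + k) =
      Real.Gamma x * Real.Gamma (c + 1) / Real.Gamma (x + c + 1) := by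
  obtain ⟨n, hn⟩ := exists_nat_gt (-x)
  induction n generalizing x with
  | zero =>
    have hx0 : 0 < x := by simpa using hn
    rw [(hasSum_altBinom_div_Beta hc hx0).tsum_eq, Beta_eq_Gamma hx0 (by linarith), add_assoc]
  | succ n ih =>
    have hx0 : x ≠ 0 := by simpa using hx 0
    have ih' := ih (x := x + 1) (fun m h => hx (m + 1) (by push_cast; linarith))
      (by push_cast at hn; linarith)
    refine mul_left_cancel₀ hx0 ?_
    rw [mul_tsum_altBinom_div hc hx, ih', Real.Gamma_add_one hx0,
      show x + 1 + c + 1 = x + c + 1 + 1 by ring]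
    by_cases h : x + c + 1 = 0
    · simp [h]
    · rw [Real.Gamma_add_one h]
      field_simp

theorem tsum_altBinom_div_neg {a c : ℝ} (ha : -1 < a) (hc : 0 ≤ c)
    (hac : ¬ ∃ z : ℤ, (z : ℝ) = a + c) :
    ∑' k : ℕ, altBinom c k / (-(a + c + 1) + k) =
      -(Real.sin (Real.pi * a) / Real.sin (Real.pi * (a + c)) * Beta (a + 1) (c + 1)) := by
  rw [tsum_altBinom_div hc (fun m h => hac ⟨m - 1, by push_cast; linarith⟩),
    Beta_eq_Gamma (by linarith) (by linarith)]
  have r1 := Real.Gamma_mul_Gamma_one_sub (-(a + c + 1))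
  have r2 := Real.Gamma_mul_Gamma_one_sub (-a)
  have hsin : Real.sin (Real.pi * (a + c)) ≠ 0 := by
    rw [Ne, Real.sin_eq_zero_iff]
    rintro ⟨z, hz⟩
    exact hac ⟨z, mul_left_cancel₀ Real.pi_ne_zero (by linarith)⟩
  rw [show Real.pi * -(a + c + 1) = -(Real.pi * (a + c) + Real.pi) by ring, Real.sin_neg,
    Real.sin_add_pi, neg_neg, show 1 - -(a + c + 1) = a + 1 + (c + 1) by ring] at r1
  rw [mul_neg, Real.sin_neg, sub_neg_eq_add, add_comm 1 a] at r2
  rw [show -(a + c + 1) + c + 1 = -a by ring]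
  have g1 : Real.Gamma (a + 1) ≠ 0 := (Real.Gamma_pos_of_pos (by linarith)).ne'
  have g2 : Real.Gamma (a + 1 + (c + 1)) ≠ 0 := (Real.Gamma_pos_of_pos (by linarith)).ne'
  rw [eq_div_iff hsin] at r1
  by_cases hs : Real.sin (Real.pi * a) = 0
  · have g0 : Real.Gamma (-a) = 0 := by simpa [hs, g1] using r2
    simp [hs, g0]
  · have g0 : Real.Gamma (-a) ≠ 0 := by
      intro h
      rw [h, zero_mul, eq_comm, div_eq_zero_iff] at r2
      simp [Real.pi_ne_zero, hs] at r2
    rw [eq_div_iff (neg_ne_zero.2 hs)] at r2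
    generalize Real.sin (Real.pi * a) = s at *
    generalize Real.sin (Real.pi * (a + c)) = s' at *
    field_simp
    linear_combination r1 - r2

theorem Res_of_not_int {m : ℝ} (h : ¬ ∃ z : ℤ, (z : ℝ) = m) :
    Res m = (Complex.exp (2 * Real.pi * Complex.I * m) - 1) /
      (2 * Real.pi * Complex.I * ((m : ℂ) + 1)) := by
  rw [Res, if_neg (fun h' => h ⟨-1, by rw [h']; simp⟩), if_neg h, mul_add, Complex.exp_add,
    mul_one, Complex.exp_two_pi_mul_I, mul_one]

theorem Res_add_intCast {m : ℝ} (h : ¬ ∃ z : ℤ, (z : ℝ) = m) (n : ℤ) :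
    Res (m + n) = (Complex.exp (2 * Real.pi * Complex.I * m) - 1) / (2 * Real.pi * Complex.I) *
      ((m + n + 1 : ℝ)⁻¹ : ℝ) := by
  rw [Res_of_not_int fun ⟨z, hz⟩ => h ⟨z - n, by push_cast; linarith⟩]
  have : Complex.exp (2 * Real.pi * Complex.I * ((m + n : ℝ) : ℂ)) =
      Complex.exp (2 * Real.pi * Complex.I * m) := by
    rw [← Complex.exp_periodic.int_mul n (2 * Real.pi * Complex.I * m)]
    congr 1
    push_cast
    ring
  rw [this]
  push_cast
  rw [div_mul_eq_div_div, ← div_eq_mul_inv]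

/-- Example 5.3 / `exm_F2`: closed formula for `F₋(m₁, m₂; m₁₂)` in terms of two
Beta functions, for `m₁ > −1`, `m₂ > −1`, `m₁₂ ≥ 0`, `m₂ ∉ ℤ`, `m₁ + m₁₂ ∉ ℤ`. -/
theorem Fminus_two_eq_beta (m₁ m₂ m₁₂ : ℝ)
    (h1 : -1 < m₁) (h2 : -1 < m₂) (h12 : 0 ≤ m₁₂)
    (hi2 : ¬ ∃ z : ℤ, (z : ℝ) = m₂) (hi1 : ¬ ∃ z : ℤ, (z : ℝ) = m₁ + m₁₂) :
    (∑' k : ℕ, Res (m₁ + m₁₂ - k) * Res (m₂ + k) * (-1 : ℂ) ^ k * (gbinom m₁₂ k : ℂ)) =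
      ((Complex.exp (2 * Real.pi * Complex.I * m₂) - 1) / (2 * Real.pi * Complex.I)) *
      ((Complex.exp (2 * Real.pi * Complex.I * (m₁ + m₁₂)) - 1) / (2 * Real.pi * Complex.I)) *
      (1 / ((m₁ : ℂ) + m₂ + m₁₂ + 2)) *
      ((Beta (m₂ + 1) (m₁₂ + 1) : ℂ) +
        ((Real.sin (Real.pi * m₁) / Real.sin (Real.pi * (m₁ + m₁₂)) : ℝ) : ℂ) *
          (Beta (m₁ + 1) (m₁₂ + 1) : ℂ)) := by
  have hA (k : ℕ) : m₁ + m₁₂ + 1 - k ≠ 0 := fun h =>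
    hi1 ⟨k - 1, by push_cast; linarith⟩
  have hB (k : ℕ) : m₂ + 1 + k ≠ 0 := by
    have : 0 < m₂ + 1 + k := by linarith [Nat.cast_nonneg (α := ℝ) k]
    exact this.ne'
  have hAB : m₁ + m₂ + m₁₂ + 2 ≠ 0 := by linarith
  have hreal : ∑' k : ℕ, altBinom m₁₂ k / ((m₁ + m₁₂ + 1 - k) * (m₂ + 1 + k)) =
      1 / (m₁ + m₂ + m₁₂ + 2) * (Beta (m₂ + 1) (m₁₂ + 1) +
        Real.sin (Real.pi * m₁) / Real.sin (Real.pi * (m₁ + m₁₂)) *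
          Beta (m₁ + 1) (m₁₂ + 1)) := by
    have hs1 := hasSum_altBinom_div_Beta h12 (x := m₂ + 1) (by linarith)
    have hs2 := (summable_altBinom_div h12 (-(m₁ + m₁₂ + 1))).hasSum
    rw [tsum_altBinom_div_neg h1 h12 hi1] at hs2
    have hs := (hs1.sub hs2).mul_left (1 / (m₁ + m₂ + m₁₂ + 2))
    rw [sub_neg_eq_add] at hs
    rw [← hs.tsum_eq]
    congr 1 with k
    have hA' : -(m₁ + m₁₂ + 1) + (k : ℝ) ≠ 0 := fun h => hA k (by linarith)
    have := hA k
    have := hB k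
    field_simp
    ring
  have hterm (k : ℕ) :
      Res (m₁ + m₁₂ - k) * Res (m₂ + k) * (-1 : ℂ) ^ k * (gbinom m₁₂ k : ℂ) =
      ((Complex.exp (2 * Real.pi * Complex.I * m₂) - 1) / (2 * Real.pi * Complex.I)) *
      ((Complex.exp (2 * Real.pi * Complex.I * (m₁ + m₁₂)) - 1) / (2 * Real.pi * Complex.I)) *
      ((altBinom m₁₂ k / ((m₁ + m₁₂ + 1 - k) * (m₂ + 1 + k)) : ℝ) : ℂ) := by
    have r1 := Res_add_intCast hi1 (-k)
    have r2 := Res_add_intCast hi2 k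
    simp only [Int.cast_neg, Int.cast_natCast, ← sub_eq_add_neg] at r1 r2
    rw [r1, r2, altBinom, show m₁ + m₁₂ - k + 1 = m₁ + m₁₂ + 1 - (k : ℝ) by ring,
      show m₂ + k + 1 = m₂ + 1 + (k : ℝ) by ring]
    simp only [Complex.ofReal_mul, Complex.ofReal_inv, Complex.ofReal_pow,
      Complex.ofReal_neg, Complex.ofReal_one, div_eq_mul_inv, mul_inv, Complex.ofReal_add]
    ring
  simp only [hterm]
  rw [tsum_mul_left, ← Complex.ofReal_tsum, hreal]
  push_cast
  ring
end

section
/- For every n ≥ 1 and every complex number q: ∑_{k=0}^n (−1)^k q^{(n−1)k} ∑_{η ∈ S_{k,n−k}bar} q^{ℓ(η)} = 0. -/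
open MeasureTheory
open scoped Classical

lemma mul_finRotate_castSucc {m : ℕ} (η : Equiv.Perm (Fin (m + 1))) (i : Fin m) :
    (η * finRotate (m + 1)) i.castSucc = η i.succ := by
  simp [Equiv.Perm.mul_apply]

lemma mul_finRotate_last {m : ℕ} (η : Equiv.Perm (Fin (m + 1))) :
    (η * finRotate (m + 1)) (Fin.last m) = η 0 := by
  simp [Equiv.Perm.mul_apply]

lemma apply_succ_pos {m : ℕ} {η : Equiv.Perm (Fin (m + 1))} (h : η 0 = 0) (i : Fin m) :
    0 < η i.succ := by
  rw [Fin.pos_iff_ne_zero, ← h]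
  exact fun e => Fin.succ_ne_zero i (η.injective e)

/-- Moving the smallest value from the first to the last position creates `m` inversions. -/
lemma invNum_mul_finRotate {m : ℕ} (η : Equiv.Perm (Fin (m + 1))) (h : η 0 = 0) :
    invNum (η * finRotate (m + 1)) = invNum η + m := by
  simp only [invNum, Finset.card_filter, Fintype.sum_prod_type]
  conv_lhs =>
    simp only [Fin.sum_univ_castSucc, mul_finRotate_castSucc, mul_finRotate_last, h]
  conv_rhs => simp only [Fin.sum_univ_succ, h]
  simp [apply_succ_pos h, Finset.sum_add_distrib, Fin.castSucc_lt_last,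
    not_lt_of_ge (Fin.le_last _)]

lemma mul_finRotate_mem_SbarFinset {m k : ℕ} (hk : k ≤ m) (η : Equiv.Perm (Fin (m + 1)))
    (h : η 0 = 0) :
    η * finRotate (m + 1) ∈ SbarFinset (m + 1) k ↔ η ∈ SbarFinset (m + 1) (k + 1) := by
  simp only [SbarFinset, Finset.mem_filter, Finset.mem_univ, true_and]
  conv_lhs =>
    simp only [Fin.forall_fin_succ', mul_finRotate_castSucc, mul_finRotate_last, h]
  conv_rhs => simp only [Fin.forall_fin_succ, h]
  simp [apply_succ_pos h, Fin.castSucc_lt_last, not_lt_of_ge (Fin.le_last _), hk]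

lemma sum_SbarFinset_last_eq_zero {m k : ℕ} (hk : k ≤ m) (q : ℂ) :
    ∑ η ∈ SbarFinset (m + 1) k with k ≤ m ∧ η (Fin.last m) = 0, q ^ invNum η =
      q ^ m * ∑ η ∈ SbarFinset (m + 1) (k + 1) with 0 < k + 1 ∧ η 0 = 0, q ^ invNum η := by
  rw [Finset.mul_sum]
  symm
  refine Finset.sum_equiv (Equiv.mulRight (finRotate (m + 1))) (fun η => ?_) (fun η hη => ?_)
  · simp only [Finset.mem_filter, Equiv.coe_mulRight, mul_finRotate_last, hk, Nat.succ_pos,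
      true_and]
    exact and_congr_left fun h => (mul_finRotate_mem_SbarFinset hk η h).symm
  · rw [Equiv.coe_mulRight, invNum_mul_finRotate η (Finset.mem_filter.mp hη).2.2, pow_add,
      mul_comm]

/-- In a shuffle the smallest value sits either first or last. -/
lemma sum_SbarFinset_eq_add (m k : ℕ) (f : Equiv.Perm (Fin (m + 1)) → ℂ) :
    ∑ η ∈ SbarFinset (m + 1) k, f η =
      ∑ η ∈ SbarFinset (m + 1) k with 0 < k ∧ η 0 = 0, f η +
      ∑ η ∈ SbarFinset (m + 1) k with k ≤ m ∧ η (Fin.last m) = 0, f η := by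
  rw [← Finset.sum_filter_add_sum_filter_not _ (fun η => 0 < k ∧ η 0 = 0)]
  congr 1
  refine Finset.sum_congr (Finset.filter_congr fun η hη => ?_) fun _ _ => rfl
  obtain ⟨hinc, hdec⟩ := (Finset.mem_filter.mp hη).2
  constructor
  · intro hne
    obtain ⟨i, hi⟩ := η.surjective 0
    by_cases hik : (i : ℕ) < k
    · rcases eq_or_ne i 0 with rfl | h0
      · exact absurd ⟨by omega, hi⟩ hne
      · have := hinc 0 i (Fin.pos_iff_ne_zero.mpr h0) hik
        simp [hi] at this
    · rcases eq_or_ne i (Fin.last m) with rfl | hl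
      · exact ⟨by simpa using hik, hi⟩
      · have := hdec i (Fin.last m) (Fin.lt_last_iff_ne_last.mpr hl) (by omega)
        simp [hi] at this
  · rintro ⟨hkm, hl⟩ ⟨hk, h0⟩
    have := congrArg Fin.val (η.injective (h0.trans hl.symm))
    simp only [Fin.val_zero, Fin.val_last] at this
    omega

/-- The `q`-analogue vanishing identity:
`∑_{k=0}^n (−1)^k q^{(n−1)k} ∑_{η ∈ S_{k,n−k}bar} q^{ℓ(η)} = 0` for every complex `q`. -/
theorem shuffle_q_sum_vanishes (n : ℕ) (hn : 1 ≤ n) (q : ℂ) :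
    ∑ k ∈ Finset.range (n + 1), (-1 : ℂ) ^ k * q ^ ((n - 1) * k) *
        ∑ η ∈ SbarFinset n k, q ^ invNum η = 0 := by
  obtain ⟨m, rfl⟩ := Nat.exists_eq_add_of_le' hn
  simp only [sum_SbarFinset_eq_add, mul_add, Finset.sum_add_distrib, Nat.add_sub_cancel]
  rw [Finset.sum_range_succ', add_assoc, Finset.sum_range_succ _ (m + 1)]
  simp only [lt_irrefl, false_and, Finset.filter_false, Finset.sum_empty, mul_zero,
    Nat.not_succ_le_self, add_zero, zero_add]
  rw [← Finset.sum_add_distrib]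
  refine Finset.sum_eq_zero fun k hk => ?_
  rw [sum_SbarFinset_last_eq_zero (Finset.mem_range_succ_iff.mp hk)]
  ring
end
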